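/- arXiv:1702.05527 — 11 statements merged into one kernel-verified Lean document; each statement's English description precedes it below -/
import Mathlib

section
/- Let F be a formula and C a clause that is literal-blocked in F. Then C is redundant with respect to F, i.e., F \ {C} and F ∪ {C} are satisfiability equivalent. -/
abbrev Var := ℕ
abbrev Lit := Var × Bool
abbrev Clause := Finset Lit
abbrev Formula := Set Clause

def Lit.compl (l : Lit) : Lit := (l.1, !l.2)

def Clause.isTaut (C : Clause) : Prop := ∃ l ∈ C, Lit.compl l ∈ C

abbrev Assign := Var → Bool

def litSat (τ : Assign) (l : Lit) : Prop := τ l.1 = l.2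
def clauseSat (τ : Assign) (C : Clause) : Prop := ∃ l ∈ C, litSat τ l
def formulaSat (τ : Assign) (F : Formula) : Prop := ∀ C ∈ F, clauseSat τ C
def satisfiable (F : Formula) : Prop := ∃ τ : Assign, formulaSat τ F
def satEquiv (F G : Formula) : Prop := satisfiable F ↔ satisfiable G
def redundant (F : Formula) (C : Clause) : Prop := satEquiv (F \ {C}) (F ∪ {C})

def env (F : Formula) (C : Clause) : Formula := {D ∈ F | ∃ l ∈ D, Lit.compl l ∈ C}
def clauseVars (C : Clause) : Set Var := {v | ∃ l ∈ C, l.1 = v}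
def formulaVars (F : Formula) : Set Var := {v | ∃ D ∈ F, ∃ l ∈ D, l.1 = v}
def extVars (F : Formula) (C : Clause) : Set Var := formulaVars (env F C) \ clauseVars C

def semBlocked (F : Formula) (C : Clause) : Prop :=
  ∀ τ : Assign, formulaSat τ (env F C) →
    ∃ τ' : Assign, formulaSat τ' (env F C ∪ {C}) ∧ ∀ v : Var, v ∉ clauseVars C → τ v = τ' v

def blocksLit (F : Formula) (C : Clause) (l : Lit) : Prop :=
  l ∈ C ∧ ∀ D ∈ F, Lit.compl l ∈ D → Clause.isTaut (C ∪ D.erase (Lit.compl l))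
def litBlocked (F : Formula) (C : Clause) : Prop := ∃ l : Lit, blocksLit F C l

def complSet (L : Finset Lit) : Finset Lit := L.image Lit.compl
def blocksSet (F : Formula) (C : Clause) (L : Finset Lit) : Prop :=
  L.Nonempty ∧ L ⊆ C ∧
    ∀ D ∈ F, (D ∩ complSet L).Nonempty → Clause.isTaut ((C \ L) ∪ complSet L ∪ D)
def setBlocked (F : Formula) (C : Clause) : Prop := ∃ L : Finset Lit, blocksSet F C L

abbrev PAssign := Var → Option Bool
def pdom (σ : PAssign) : Set Var := {v | σ v ≠ none}
def plitSat (σ : PAssign) (l : Lit) : Prop := σ l.1 = some l.2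
def pclauseSat (σ : PAssign) (C : Clause) : Prop := ∃ l ∈ C, plitSat σ l
def pformulaSat (σ : PAssign) (F : Formula) : Prop := ∀ C ∈ F, pclauseSat σ C
def restrictF (F : Formula) (σ : PAssign) : Formula := {D ∈ F | ¬ pclauseSat σ D}
def punion (σ₁ σ₂ : PAssign) : PAssign := fun v => (σ₁ v).orElse (fun _ => σ₂ v)

def superBlocked (F : Formula) (C : Clause) : Prop :=
  ∀ σ : PAssign, pdom σ = extVars F C → setBlocked (restrictF F σ) C

def litClauses (F : Formula) (l : Lit) : Formula := {D ∈ F | l ∈ D}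
def resolvents (F : Formula) (x : Var) : Formula :=
  {R | ∃ C ∈ litClauses F (x, true), ∃ D ∈ litClauses F (x, false),
    R = C.erase (x, true) ∪ D.erase (x, false) ∧ ¬ Clause.isTaut R}
def elimVar (F : Formula) (x : Var) : Formula :=
  (F \ (litClauses F (x, true) ∪ litClauses F (x, false))) ∪ resolvents F x

def asymLit (F : Formula) (C : Clause) (l : Lit) : Prop :=
  ∃ D : Clause, D ⊆ C ∧ insert (Lit.compl l) D ∈ F \ {C}
def asymTaut (F : Formula) (C : Clause) : Prop :=
  ∃ ls : List Lit, Clause.isTaut (C ∪ ls.toFinset) ∧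
    ∀ i : Fin ls.length, asymLit F (C ∪ (ls.take i.val).toFinset) (ls.get i)
def ratPair (F : Formula) (C : Clause) : Prop :=
  asymTaut F C ∨
    ∃ l ∈ C, ∀ D ∈ F, Lit.compl l ∈ D → asymTaut F (C ∪ D.erase (Lit.compl l))

theorem clauseSat_of_isTaut (τ : Assign) {C : Clause} (h : Clause.isTaut C) : clauseSat τ C := by
  obtain ⟨k, hk, hk'⟩ := h
  by_cases hs : litSat τ k
  · exact ⟨k, hk, hs⟩
  · refine ⟨Lit.compl k, hk', ?_⟩
    simp only [litSat, Lit.compl] at hs ⊢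
    exact Bool.eq_not_of_ne hs

/-- Making `l` true keeps every true literal other than the complement of `l` true. -/
theorem litSat_update {τ : Assign} {k l : Lit} (hk : litSat τ k) (hkl : k ≠ Lit.compl l) :
    litSat (Function.update τ l.1 l.2) k := by
  unfold litSat at hk ⊢
  by_cases hv : k.1 = l.1
  · rw [hv, Function.update_self]
    by_contra hne
    exact hkl (Prod.ext hv (Bool.eq_not_of_ne (Ne.symm hne)))
  · rwa [Function.update_of_ne hv]

/-- An assignment falsifying a clause blocked by `l` can be repaired by making `l` true. -/
theorem formulaSat_update_of_blocksLit {F : Formula} {C : Clause} {l : Lit} {τ : Assign}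
    (hl : blocksLit F C l) (hτ : formulaSat τ (F \ {C})) (hC : ¬ clauseSat τ C) :
    formulaSat (Function.update τ l.1 l.2) (F ∪ {C}) := by
  intro D hD
  by_cases hDC : D = C
  · exact ⟨l, hDC ▸ hl.1, by simp [litSat]⟩
  have hDF : D ∈ F := hD.resolve_right hDC
  suffices ∃ k ∈ D, litSat τ k ∧ k ≠ Lit.compl l by
    obtain ⟨k, hkD, hk, hne⟩ := this
    exact ⟨k, hkD, litSat_update hk hne⟩
  by_cases hlD : Lit.compl l ∈ D
  · obtain ⟨k, hk, hks⟩ := clauseSat_of_isTaut τ (hl.2 D hDF hlD)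
    rcases Finset.mem_union.mp hk with hkC | hkD
    · exact absurd ⟨k, hkC, hks⟩ hC
    · exact ⟨k, Finset.mem_of_mem_erase hkD, hks, Finset.ne_of_mem_erase hkD⟩
  · obtain ⟨k, hkD, hks⟩ := hτ D ⟨hDF, hDC⟩
    exact ⟨k, hkD, hks, fun h => hlD (h ▸ hkD)⟩

theorem litBlocked_redundant (F : Formula) (C : Clause) (h : litBlocked F C) :
    redundant F C := by
  obtain ⟨l, hl⟩ := h
  constructor
  · rintro ⟨τ, hτ⟩
    by_cases hC : clauseSat τ C
    · refine ⟨τ, fun D hD => ?_⟩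
      by_cases hDC : D = C
      · exact hDC ▸ hC
      · exact hτ D ⟨hD.resolve_right hDC, hDC⟩
    · exact ⟨_, formulaSat_update_of_blocksLit hl hτ hC⟩
  · rintro ⟨τ, hτ⟩
    exact ⟨τ, fun D hD => hτ D (Or.inl hD.1)⟩
end

section
/- Let F be a formula and C a clause that is semantically blocked in F. Then C is redundant with respect to F, i.e., F \ {C} and F ∪ {C} are satisfiability equivalent. -/
theorem Lit.mem_or_compl_mem_of_mem_clauseVars {C : Clause} {l : Lit}
    (h : l.1 ∈ clauseVars C) : l ∈ C ∨ Lit.compl l ∈ C := by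
  obtain ⟨k, hk, hkl⟩ := h
  obtain ⟨v, b⟩ := l
  obtain ⟨w, c⟩ := k
  dsimp only at hkl
  subst hkl
  cases b <;> cases c <;> simp [Lit.compl, hk]

theorem Clause.isTaut.clauseSat {C : Clause} (h : C.isTaut) (τ : Assign) : clauseSat τ C := by
  obtain ⟨l, hl, hl'⟩ := h
  by_cases hτ : τ l.1 = l.2
  · exact ⟨l, hl, hτ⟩
  · exact ⟨_, hl', Bool.eq_not_of_ne hτ⟩

/-- If `τ` falsifies `C`, then clauses outside the resolution environment of `C` that `τ`
satisfies remain satisfied when `τ` is changed on the variables of `C` only. -/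
theorem clauseSat_of_notMem_env {F : Formula} {C D : Clause} {τ τ' : Assign}
    (hC : ¬ clauseSat τ C) (hDF : D ∈ F) (hD : D ∉ env F C) (hτ : clauseSat τ D)
    (hagree : ∀ v : Var, v ∉ clauseVars C → τ v = τ' v) : clauseSat τ' D := by
  obtain ⟨l, hl, hsat⟩ := hτ
  refine ⟨l, hl, (hagree l.1 fun hv => ?_).symm.trans hsat⟩
  rcases Lit.mem_or_compl_mem_of_mem_clauseVars hv with h | h
  · exact hC ⟨l, h, hsat⟩
  · exact hD ⟨hDF, l, hl, h⟩

theorem semBlocked_redundant (F : Formula) (C : Clause) (h : semBlocked F C) :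
    redundant F C := by
  refine ⟨?_, fun ⟨τ, hτ⟩ => ⟨τ, fun D hD => hτ D (Or.inl hD.1)⟩⟩
  rintro ⟨τ, hτ⟩
  by_cases hC : clauseSat τ C
  · refine ⟨τ, fun D hD => ?_⟩
    by_cases hDC : D = C
    · exact hDC ▸ hC
    · exact hτ D ⟨hD.resolve_right hDC, hDC⟩
  · have henv : formulaSat τ (env F C) := by
      rintro D ⟨hDF, hD⟩
      refine hτ D ⟨hDF, fun hDC => hC ?_⟩
      rw [Set.mem_singleton_iff] at hDC
      subst hDC
      exact Clause.isTaut.clauseSat hD τ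
    obtain ⟨τ', hτ', hagree⟩ := h τ henv
    refine ⟨τ', fun D hD => ?_⟩
    by_cases hDC : D ∈ env F C ∪ {C}
    · exact hτ' D hDC
    · have hne : D ∉ ({C} : Formula) := fun h => hDC (Or.inr h)
      have hDF : D ∈ F := hD.resolve_right hne
      exact clauseSat_of_notMem_env hC hDF (fun h => hDC (Or.inl h)) (hτ D ⟨hDF, hne⟩) hagree
end

section
/- Semantic blocking is the most general local redundancy property: if P is any local redundancy property, then for every pair (F, C) ∈ P, the clause C is semantically blocked in F. -/
/-- The unit clauses fixing every variable outside `C` to its value under `τ`. -/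
def unitsOutside (τ : Assign) (C : Clause) : Formula :=
  {D | ∃ v, v ∉ clauseVars C ∧ D = {(v, τ v)}}

lemma env_env_union_unitsOutside (F : Formula) (C : Clause) (τ : Assign) :
    env (env F C ∪ unitsOutside τ C) C = env F C := by
  ext D
  constructor
  · rintro ⟨hD | ⟨v, hv, rfl⟩, l, hl, hlC⟩
    · exact hD
    · rw [Finset.mem_singleton] at hl
      subst hl
      exact absurd ⟨_, hlC, rfl⟩ hv
  · exact fun hD => ⟨Or.inl hD, hD.2⟩

lemma formulaSat_unitsOutside_self (τ : Assign) (C : Clause) :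
    formulaSat τ (unitsOutside τ C) := by
  rintro _ ⟨v, -, rfl⟩
  exact ⟨_, Finset.mem_singleton_self _, rfl⟩

lemma eq_of_formulaSat_unitsOutside {τ τ' : Assign} {C : Clause}
    (h : formulaSat τ' (unitsOutside τ C)) {v : Var} (hv : v ∉ clauseVars C) : τ v = τ' v := by
  obtain ⟨l, hl, hsat⟩ := h _ ⟨v, hv, rfl⟩
  rw [Finset.mem_singleton] at hl
  subst hl
  exact hsat.symm

theorem semBlocked_most_general_local (P : Set (Formula × Clause))
    (hred : ∀ p ∈ P, redundant p.1 p.2)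
    (hloc : ∀ (C : Clause) (F F' : Formula), env F C = env F' C →
      ((F, C) ∈ P ↔ (F', C) ∈ P)) :
    ∀ p ∈ P, semBlocked p.1 p.2 := by
  rintro ⟨F, C⟩ hp τ hτ
  have hP := (hloc C F _ (env_env_union_unitsOutside F C τ).symm).1 hp
  obtain ⟨τ', hτ'⟩ := (hred _ hP).1
    ⟨τ, fun D hD => hD.1.elim (hτ D) (formulaSat_unitsOutside_self τ C D)⟩
  refine ⟨τ', fun D hD => hτ' D (hD.imp_left Or.inl), fun v hv => ?_⟩
  exact eq_of_formulaSat_unitsOutside (fun D hD => hτ' D (Or.inl (Or.inr hD))) hv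
end

section
/- Set-blocking is strictly more general than literal-blocking: every clause that is literal-blocked in a formula F is also set-blocked in F, and there exist a formula F and a clause C such that C is set-blocked in F but not literal-blocked in F. -/
@[simp] theorem Lit.compl_compl (l : Lit) : Lit.compl (Lit.compl l) = l := by
  simp [Lit.compl]

theorem Clause.isTaut.setBlocked {C : Clause} (hC : Clause.isTaut C) (F : Formula) :
    setBlocked F C := by
  obtain ⟨m, hm, hm'⟩ := hC
  refine ⟨{m, Lit.compl m}, by simp, by simp [Finset.insert_subset_iff, hm, hm'],
    fun D _ _ => ⟨m, ?_, ?_⟩⟩ <;> simp [complSet]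

theorem litBlocked.setBlocked {F : Formula} {C : Clause} (h : litBlocked F C) :
    setBlocked F C := by
  by_cases hC : Clause.isTaut C
  · exact hC.setBlocked F
  obtain ⟨l, hl, hF⟩ := h
  refine ⟨{l}, by simp, by simpa using hl, fun D hD hne => ?_⟩
  have hlD : Lit.compl l ∈ D := by
    obtain ⟨m, hm⟩ := hne
    simp only [complSet, Finset.image_singleton, Finset.mem_inter, Finset.mem_singleton] at hm
    exact hm.2 ▸ hm.1
  obtain ⟨m, hm, hm'⟩ := hF D hD hlD
  by_cases hl' : l ∈ D
  · exact ⟨l, by simp [hl'], by simp [hlD]⟩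
  have hcl : Lit.compl l ∉ C := fun h => hC ⟨l, hl, h⟩
  have mem_of_mem : ∀ k ∈ C ∪ D.erase (Lit.compl l), k ≠ l →
      k ∈ (C \ {l}) ∪ complSet {l} ∪ D := by
    intro k hk hkl
    simp only [Finset.mem_union, Finset.mem_erase, Finset.mem_sdiff, Finset.mem_singleton] at hk ⊢
    tauto
  have compl_notMem : Lit.compl l ∉ C ∪ D.erase (Lit.compl l) := by simp [hcl]
  refine ⟨m, mem_of_mem m hm ?_, mem_of_mem _ hm' ?_⟩
  · rintro rfl
    exact compl_notMem hm'
  · intro h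
    have hml : m = Lit.compl l := by rw [← h, Lit.compl_compl]
    exact compl_notMem (hml ▸ hm)

/-- The clause `x ∨ y` is set-blocked, but not literal-blocked, by `x ↔ y`. -/
theorem exists_setBlocked_not_litBlocked :
    ∃ (F : Formula) (C : Clause), setBlocked F C ∧ ¬ litBlocked F C := by
  refine ⟨{{(0, false), (1, true)}, {(0, true), (1, false)}}, {(0, true), (1, true)},
    ⟨{(0, true), (1, true)}, by simp, subset_rfl, ?_⟩, ?_⟩
  · rintro D (rfl | rfl) -
    · exact ⟨(1, true), by simp, by simp [complSet, Lit.compl]⟩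
    · exact ⟨(0, true), by simp, by simp [complSet, Lit.compl]⟩
  · rintro ⟨l, hl, hF⟩
    simp only [Finset.mem_insert, Finset.mem_singleton] at hl
    rcases hl with rfl | rfl
    · have h := hF _ (Or.inl rfl) (by simp [Lit.compl])
      revert h
      unfold Clause.isTaut Lit.compl
      decide
    · have h := hF _ (Or.inr rfl) (by simp [Lit.compl])
      revert h
      unfold Clause.isTaut Lit.compl
      decide

theorem setBlocked_strictly_more_general_than_litBlocked :
    (∀ (F : Formula) (C : Clause), litBlocked F C → setBlocked F C) ∧
    (∃ (F : Formula) (C : Clause), setBlocked F C ∧ ¬ litBlocked F C) :=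
  ⟨fun _ _ h => h.setBlocked, exists_setBlocked_not_litBlocked⟩
end

section
/- Super-blocking is strictly more general than set-blocking: every clause that is set-blocked in a formula F is also super-blocked in F, and there exist a formula F and a clause C such that C is super-blocked in F but not set-blocked in F. -/
theorem setBlocked.mono {F G : Formula} {C : Clause} (h : G ⊆ F) (hF : setBlocked F C) :
    setBlocked G C :=
  let ⟨L, hne, hsub, hb⟩ := hF
  ⟨L, hne, hsub, fun D hD => hb D (h hD)⟩

instance (C : Clause) : Decidable C.isTaut :=
  inferInstanceAs (Decidable (∃ l ∈ C, Lit.compl l ∈ C))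

/-- The clause `x₀ ∨ x₁`, super-blocked but not set-blocked in `splitFormula`. -/
def splitClause : Clause := {(0, true), (1, true)}

/-- The formula `(¬x₀ ∨ x₂) ∧ (¬x₁ ∨ ¬x₂)`. -/
def splitFormula : Formula := {{(0, false), (2, true)}, {(1, false), (2, false)}}

theorem two_mem_extVars : 2 ∈ extVars splitFormula splitClause := by
  refine ⟨⟨{(0, false), (2, true)}, ⟨Or.inl rfl, (0, false), by decide, by decide⟩,
    (2, true), by decide, rfl⟩, ?_⟩
  rintro ⟨l, hl, h⟩
  revert h
  revert l
  decide

theorem superBlocked_splitClause : superBlocked splitFormula splitClause := by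
  intro σ hσ
  have h2 : σ 2 ≠ none := (hσ ▸ two_mem_extVars : 2 ∈ pdom σ)
  obtain ⟨b, hb⟩ := Option.ne_none_iff_exists'.mp h2
  cases b
  · refine ⟨{(1, true)}, by decide, by decide, ?_⟩
    rintro D ⟨rfl | rfl, hD⟩ hne
    · exact absurd hne (by decide)
    · exact absurd ⟨(2, false), by decide, hb⟩ hD
  · refine ⟨{(0, true)}, by decide, by decide, ?_⟩
    rintro D ⟨rfl | rfl, hD⟩ hne
    · exact absurd ⟨(2, true), by decide, hb⟩ hD
    · exact absurd hne (by decide)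

theorem not_setBlocked_splitClause : ¬ setBlocked splitFormula splitClause := by
  rintro ⟨L, hne, hsub, h⟩
  have h₀ := h _ (Or.inl rfl)
  have h₁ := h _ (Or.inr rfl)
  clear h
  rw [← Finset.mem_powerset] at hsub
  revert hne h₀ h₁
  revert L
  decide

theorem superBlocked_strictly_more_general_than_setBlocked :
    (∀ (F : Formula) (C : Clause), setBlocked F C → superBlocked F C) ∧
    (∃ (F : Formula) (C : Clause), superBlocked F C ∧ ¬ setBlocked F C) := by
  refine ⟨fun F C h σ _ => h.mono fun D hD => hD.1, ?_⟩
  exact ⟨splitFormula, splitClause, superBlocked_splitClause, not_setBlocked_splitClause⟩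
end

section
/- Let C be a non-tautological clause and F a formula, and let G = ext_F(C) and L = var(C). Then C is semantically blocked in F if and only if for every assignment σ_G whose domain is G there exists an assignment σ_L whose domain is L such that the combined assignment σ_G ∪ σ_L satisfies every clause of env_F(C) ∪ {C}. -/
theorem mem_clauseVars_or_mem_extVars {F : Formula} {C D : Clause} {l : Lit}
    (hD : D ∈ env F C ∪ {C}) (hl : l ∈ D) : l.1 ∈ clauseVars C ∨ l.1 ∈ extVars F C := by
  by_cases h : l.1 ∈ clauseVars C
  · exact Or.inl h
  · rcases hD with hD | rfl
    · exact Or.inr ⟨⟨D, hD, l, hl, rfl⟩, h⟩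
    · exact Or.inl ⟨l, hl, rfl⟩

/-- An assignment falsifying every literal of `C` satisfies the resolution environment of `C`. -/
theorem formulaSat_env_of_falsifies {F : Formula} {C : Clause} {τ : Assign}
    (h : ∀ l ∈ C, τ l.1 = !l.2) : formulaSat τ (env F C) := by
  rintro D ⟨-, l, hl, hlC⟩
  exact ⟨l, hl, by simpa [Lit.compl, litSat] using h _ hlC⟩

theorem decide_mem_eq_not_of_not_isTaut {C : Clause} (hC : ¬ C.isTaut) {l : Lit} (hl : l ∈ C) :
    decide ((l.1, false) ∈ C) = !l.2 := by
  obtain ⟨v, b⟩ := l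
  cases b
  · simpa using hl
  · have : (v, false) ∉ C := fun h => hC ⟨_, hl, h⟩
    simpa using this

theorem eq_none_of_pdom_eq {σ : PAssign} {S : Set Var} (h : pdom σ = S) {v : Var} (hv : v ∉ S) :
    σ v = none := by
  subst h
  simpa [pdom] using hv

theorem exists_eq_some_of_pdom_eq {σ : PAssign} {S : Set Var} (h : pdom σ = S) {v : Var}
    (hv : v ∈ S) : ∃ b, σ v = some b := by
  subst h
  exact Option.ne_none_iff_exists'.mp hv

open Classical in
/-- The restriction of a total assignment to a set of variables. -/
noncomputable def restrictAssign (τ : Assign) (S : Set Var) : PAssign :=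
  fun v => if v ∈ S then some (τ v) else none

theorem pdom_restrictAssign (τ : Assign) (S : Set Var) : pdom (restrictAssign τ S) = S := by
  ext v
  simp [pdom, restrictAssign]

theorem pformulaSat_iff_of_agree {σ : PAssign} {τ : Assign} {F : Formula}
    (h : ∀ D ∈ F, ∀ l ∈ D, σ l.1 = some (τ l.1)) : pformulaSat σ F ↔ formulaSat τ F := by
  refine forall₂_congr fun D hD => exists_congr fun l => and_congr_right fun hl => ?_
  simp [plitSat, litSat, h D hD l hl]

theorem semBlocked_iff_qbf (F : Formula) (C : Clause) (hC : ¬ Clause.isTaut C) :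
    semBlocked F C ↔
      ∀ σG : PAssign, pdom σG = extVars F C →
        ∃ σL : PAssign, pdom σL = clauseVars C ∧
          pformulaSat (punion σG σL) (env F C ∪ {C}) := by
  constructor
  · intro h σG hG
    obtain ⟨τ', hτ', hagree⟩ := h (fun v => (σG v).getD (decide ((v, false) ∈ C)))
      (formulaSat_env_of_falsifies fun l hl => by
        have hnone : σG l.1 = none := eq_none_of_pdom_eq hG fun hv => hv.2 ⟨l, hl, rfl⟩
        simpa only [hnone, Option.getD_none] using decide_mem_eq_not_of_not_isTaut hC hl)
    refine ⟨restrictAssign τ' (clauseVars C), pdom_restrictAssign _ _,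
      (pformulaSat_iff_of_agree fun D hD l hl => ?_).mpr hτ'⟩
    rcases mem_clauseVars_or_mem_extVars hD hl with hv | hv
    · simp [punion, eq_none_of_pdom_eq hG fun hw => hw.2 hv, restrictAssign, hv]
    · obtain ⟨b, hb⟩ := exists_eq_some_of_pdom_eq hG hv
      simpa [punion, hb] using hagree l.1 hv.2
  · intro h τ _
    obtain ⟨σL, hL, hsat⟩ := h _ (pdom_restrictAssign τ (extVars F C))
    refine ⟨fun v => (σL v).getD (τ v),
      (pformulaSat_iff_of_agree fun D hD l hl => ?_).mp hsat, fun v hv => ?_⟩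
    · rcases mem_clauseVars_or_mem_extVars hD hl with hv | hv
      · obtain ⟨b, hb⟩ := exists_eq_some_of_pdom_eq hL hv
        have hext : l.1 ∉ extVars F C := fun hw => hw.2 hv
        simp [punion, restrictAssign, hext, hb]
      · simp [punion, restrictAssign, hv, eq_none_of_pdom_eq hL hv.2]
    · simp [eq_none_of_pdom_eq hL hv]
end

section
/- Let C be a clause, F a formula, G = ext_F(C), and L = var(C). Then C is semantically blocked in F if and only if C is a tautology, or for every assignment σ_G whose domain is G there exists an assignment σ_L whose domain is L such that the combined assignment σ_G ∪ σ_L satisfies every clause of env_F(C) ∪ {C}. -/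
theorem not_mem_extVars_of_mem_clauseVars {F : Formula} {C : Clause} {v : Var}
    (h : v ∈ clauseVars C) : v ∉ extVars F C := fun hv => hv.2 h

theorem mem_extVars_of_mem {F : Formula} {C D : Clause} {l : Lit}
    (hD : D ∈ env F C ∪ {C}) (hl : l ∈ D) (h : l.1 ∉ clauseVars C) : l.1 ∈ extVars F C := by
  rcases hD with hD | rfl
  · exact ⟨⟨D, hD, l, hl, rfl⟩, h⟩
  · exact absurd ⟨l, hl, rfl⟩ h

theorem semBlocked_of_isTaut {F : Formula} {C : Clause} (hC : Clause.isTaut C) :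
    semBlocked F C := by
  intro τ hτ
  refine ⟨τ, ?_, fun _ _ => rfl⟩
  rintro D (hD | rfl)
  · exact hτ D hD
  · obtain ⟨⟨v, b⟩, hl, hl'⟩ := hC
    by_cases h : τ v = b
    · exact ⟨_, hl, h⟩
    · exact ⟨_, hl', Bool.eq_not.2 h⟩

/-- A clause that is not a tautology is falsified by some assignment that may be prescribed freely
outside the variables of the clause. -/
theorem exists_litSat_of_compl_mem {C : Clause} (hC : ¬ Clause.isTaut C) (τ : Assign) :
    ∃ τ' : Assign, (∀ l : Lit, Lit.compl l ∈ C → litSat τ' l) ∧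
      ∀ v, v ∉ clauseVars C → τ' v = τ v := by
  refine ⟨fun v => if (v, false) ∈ C then true else if (v, true) ∈ C then false else τ v, ?_, ?_⟩
  · rintro ⟨v, b⟩ hl
    cases b
    · have h : (v, false) ∉ C := fun h => hC ⟨_, h, hl⟩
      simp_all [litSat, Lit.compl]
    · simp_all [litSat, Lit.compl]
  · intro v hv
    have h (b : Bool) : (v, b) ∉ C := fun h => hv ⟨_, h, rfl⟩
    simp [h]

theorem formulaSat_env_of_compl_mem {F : Formula} {C : Clause} {τ : Assign}
    (hτ : ∀ l : Lit, Lit.compl l ∈ C → litSat τ l) : formulaSat τ (env F C) := by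
  rintro D ⟨-, l, hl, hlC⟩
  exact ⟨l, hl, hτ l hlC⟩

theorem semBlocked_iff_taut_or_qbf (F : Formula) (C : Clause) :
    semBlocked F C ↔
      Clause.isTaut C ∨
        ∀ σG : PAssign, pdom σG = extVars F C →
          ∃ σL : PAssign, pdom σL = clauseVars C ∧
            pformulaSat (punion σG σL) (env F C ∪ {C}) := by
  classical
  constructor
  · refine fun hB => or_iff_not_imp_left.2 fun hC σG hG => ?_
    obtain ⟨τ, hτ, hτG⟩ := exists_litSat_of_compl_mem hC (fun v => (σG v).getD false)
    obtain ⟨τ', hτ', hagree⟩ := hB τ (formulaSat_env_of_compl_mem hτ)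
    refine ⟨fun v => if v ∈ clauseVars C then some (τ' v) else none, ?_, fun D hD => ?_⟩
    · ext v
      simp [pdom]
    · obtain ⟨l, hl, hsat⟩ := hτ' D hD
      refine ⟨l, hl, ?_⟩
      have hsat : τ' l.1 = l.2 := hsat
      by_cases hv : l.1 ∈ clauseVars C
      · have hnone : σG l.1 = none := by
          have h := not_mem_extVars_of_mem_clauseVars (F := F) hv
          rw [← hG] at h
          simpa [pdom] using h
        simp [plitSat, punion, hnone, hv, hsat]
      · have h := mem_extVars_of_mem hD hl hv
        rw [← hG] at h
        obtain ⟨b, hb⟩ := Option.ne_none_iff_exists'.1 h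
        have hb' : b = l.2 := by
          rw [← hsat, ← hagree _ hv, hτG _ hv, hb]
          rfl
        simp [plitSat, punion, hb, hb']
  · rintro (hC | hQ)
    · exact semBlocked_of_isTaut hC
    intro τ _
    obtain ⟨σL, hL, hsat⟩ := hQ (fun v => if v ∈ extVars F C then some (τ v) else none)
      (by ext v; simp [pdom])
    have hL' (v : Var) : σL v ≠ none ↔ v ∈ clauseVars C := by rw [← hL]; rfl
    refine ⟨fun v => (σL v).getD (τ v), fun D hD => ?_, fun v hv => ?_⟩
    · obtain ⟨l, hl, hls⟩ := hsat D hD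
      refine ⟨l, hl, ?_⟩
      by_cases hv : l.1 ∈ clauseVars C
      · have h := not_mem_extVars_of_mem_clauseVars (F := F) hv
        simp_all [plitSat, punion, litSat]
      · have h := mem_extVars_of_mem hD hl hv
        have hnone : σL l.1 = none := not_not.1 fun h' => hv ((hL' _).1 h')
        simp_all [plitSat, punion, litSat]
    · have hnone : σL v = none := not_not.1 fun h' => hv ((hL' _).1 h')
      simp [hnone]
end

section
/- Correctness of the reduction from SAT to the set-blocking problem: let F be a formula whose variables are x_1, …, x_n, and let u, x_1', …, x_n' be pairwise distinct fresh variables not occurring in F. Let C = {u, x_1, x_1', …, x_n, x_n'}, for each clause D ∈ F let T(D) = {¬u} ∪ {x_i | x_i ∈ D} ∪ {x_i' | ¬x_i ∈ D}, and let F' = {T(D) | D ∈ F} ∪ ⋃_{i=1}^{n} { {¬x_i, ¬x_i'}, {¬x_i, u}, {¬x_i', u} }. Then F is satisfiable if and only if C is set-blocked in F'. -/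
theorem mem_complSet_iff (L : Finset Lit) (v : Var) (b : Bool) :
    ((v, b) : Lit) ∈ complSet L ↔ ((v, !b) : Lit) ∈ L := by
  simp only [complSet, Finset.mem_image, Lit.compl, Prod.exists, Prod.mk.injEq]
  constructor
  · rintro ⟨w, c, h, rfl, rfl⟩
    simpa using h
  · intro h
    exact ⟨v, !b, h, rfl, by simp⟩

theorem Clause.isTaut_iff (D : Clause) :
    D.isTaut ↔ ∃ v : Var, ((v, true) : Lit) ∈ D ∧ ((v, false) : Lit) ∈ D := by
  constructor
  · rintro ⟨⟨v, b⟩, h, h'⟩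
    cases b
    · exact ⟨v, h', h⟩
    · exact ⟨v, h, h'⟩
  · rintro ⟨v, h, h'⟩
    exact ⟨(v, true), h, h'⟩

/-- For a clause `C` of positive literals, a flipped clause together with a non-tautological
clause `D` is a tautology exactly when `D` clashes with the flipped clause. -/
theorem isTaut_flip_union_iff {C D : Clause} {L : Finset Lit}
    (hpos : ∀ v : Var, ((v, false) : Lit) ∉ C) (hL : L ⊆ C) (hD : ¬ D.isTaut) :
    Clause.isTaut ((C \ L) ∪ complSet L ∪ D) ↔
      (∃ v : Var, ((v, true) : Lit) ∈ D ∧ ((v, true) : Lit) ∈ L) ∨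
      (∃ v : Var, ((v, false) : Lit) ∈ D ∧ ((v, true) : Lit) ∈ C ∧ ((v, true) : Lit) ∉ L) := by
  have hLpos : ∀ v : Var, ((v, false) : Lit) ∉ L := fun v h => hpos v (hL h)
  rw [Clause.isTaut_iff] at hD ⊢
  simp only [Finset.mem_union, Finset.mem_sdiff, mem_complSet_iff, Bool.not_true, Bool.not_false,
    hpos, hLpos, or_false, false_or, not_false_eq_true, and_true]
  constructor
  · rintro ⟨v, h₁, h₂⟩
    rcases h₁ with ⟨h₁, h₁'⟩ | h₁ <;> rcases h₂ with h₂ | h₂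
    · exact absurd h₂ h₁'
    · exact Or.inr ⟨v, h₂, h₁, h₁'⟩
    · exact Or.inl ⟨v, h₁, h₂⟩
    · exact absurd ⟨v, h₁, h₂⟩ hD
  · rintro (⟨v, h, h'⟩ | ⟨v, h, h'⟩)
    · exact ⟨v, Or.inr h, Or.inl h'⟩
    · exact ⟨v, Or.inl h', Or.inr h⟩

theorem inter_complSet_nonempty_iff {D : Clause} {L : Finset Lit}
    (hL : ∀ v : Var, ((v, false) : Lit) ∉ L) :
    (D ∩ complSet L).Nonempty ↔
      ∃ v : Var, ((v, false) : Lit) ∈ D ∧ ((v, true) : Lit) ∈ L := by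
  constructor
  · rintro ⟨⟨v, b⟩, h⟩
    rw [Finset.mem_inter, mem_complSet_iff] at h
    cases b
    · exact ⟨v, h⟩
    · exact absurd h.2 (hL v)
  · rintro ⟨v, h, h'⟩
    exact ⟨(v, false), Finset.mem_inter.2 ⟨h, (mem_complSet_iff _ _ _).2 h'⟩⟩

theorem sat_iff_setBlocked_reduction (n : ℕ) (F : Formula) (x x' : Fin n → Var) (u : Var)
    (hxinj : Function.Injective x) (hx'inj : Function.Injective x')
    (hxx' : ∀ i j : Fin n, x i ≠ x' j)
    (hux : ∀ i : Fin n, u ≠ x i) (hux' : ∀ i : Fin n, u ≠ x' i)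
    (hFvars : formulaVars F = Set.range x)
    (C : Clause)
    (hC : C = insert ((u, true) : Lit)
      ((Finset.univ.image fun i : Fin n => ((x i, true) : Lit)) ∪
       (Finset.univ.image fun i : Fin n => ((x' i, true) : Lit))))
    (T : Clause → Clause)
    (hT : ∀ D : Clause, T D = insert ((u, false) : Lit)
      (((Finset.univ.filter fun i : Fin n => ((x i, true) : Lit) ∈ D).image
          fun i => ((x i, true) : Lit)) ∪
       ((Finset.univ.filter fun i : Fin n => ((x i, false) : Lit) ∈ D).image
          fun i => ((x' i, true) : Lit))))
    (F' : Formula)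
    (hF' : F' = (T '' F) ∪
      ⋃ i : Fin n, ({ ({((x i, false) : Lit), ((x' i, false) : Lit)} : Clause),
                      ({((x i, false) : Lit), ((u, true) : Lit)} : Clause),
                      ({((x' i, false) : Lit), ((u, true) : Lit)} : Clause) } : Set Clause)) :
    satisfiable F ↔ setBlocked F' C := by
  have memC : ∀ v : Var, ((v, true) : Lit) ∈ C ↔ v = u ∨ (∃ i, x i = v) ∨ ∃ i, x' i = v := by
    intro v
    simp [hC]
  have hpos : ∀ v : Var, ((v, false) : Lit) ∉ C := by
    intro v
    simp [hC]
  have memT_true : ∀ (D : Clause) (v : Var), ((v, true) : Lit) ∈ T D ↔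
      (∃ i, ((x i, true) : Lit) ∈ D ∧ x i = v) ∨ ∃ i, ((x i, false) : Lit) ∈ D ∧ x' i = v := by
    intro D v
    simp [hT]
  have memT_false : ∀ (D : Clause) (v : Var), ((v, false) : Lit) ∈ T D ↔ v = u := by
    intro D v
    simp [hT]
  have hforall : ∀ P : Clause → Prop, (∀ D ∈ F', P D) ↔ (∀ D ∈ F, P (T D)) ∧
      ∀ i, P {(x i, false), (x' i, false)} ∧ P {(x i, false), (u, true)} ∧
        P {(x' i, false), (u, true)} := by
    intro P
    subst hF'
    constructor
    · intro h
      refine ⟨fun D hD => h _ (Or.inl ⟨D, hD, rfl⟩), fun i => ⟨?_, ?_, ?_⟩⟩ <;>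
        exact h _ (Or.inr (Set.mem_iUnion.2 ⟨i, by simp⟩))
    · rintro ⟨h₁, h₂⟩ D (⟨E, hE, rfl⟩ | hD)
      · exact h₁ E hE
      · obtain ⟨i, hi⟩ := Set.mem_iUnion.1 hD
        simp only [Set.mem_insert_iff, Set.mem_singleton_iff] at hi
        rcases hi with rfl | rfl | rfl
        · exact (h₂ i).1
        · exact (h₂ i).2.1
        · exact (h₂ i).2.2
  have hnotTaut : ∀ D ∈ F', ¬ D.isTaut := by
    rw [hforall]
    simp only [Clause.isTaut_iff, memT_true, memT_false]
    refine ⟨?_, fun i => ⟨?_, ?_, ?_⟩⟩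
    · rintro D - ⟨v, ⟨i, -, h⟩ | ⟨i, -, h⟩, rfl⟩
      · exact hux i h.symm
      · exact hux' i h.symm
    · simp
    · simpa using hux i
    · simpa using hux' i
  have hblocks : ∀ L : Finset Lit, L ⊆ C →
      ((∀ D ∈ F', (D ∩ complSet L).Nonempty → Clause.isTaut ((C \ L) ∪ complSet L ∪ D)) ↔
        ∀ D ∈ F', (∃ v : Var, ((v, false) : Lit) ∈ D ∧ ((v, true) : Lit) ∈ L) →
          (∃ v : Var, ((v, true) : Lit) ∈ D ∧ ((v, true) : Lit) ∈ L) ∨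
          (∃ v : Var, ((v, false) : Lit) ∈ D ∧ ((v, true) : Lit) ∈ C ∧
            ((v, true) : Lit) ∉ L)) := by
    intro L hL
    refine forall₂_congr fun D hD => ?_
    rw [inter_complSet_nonempty_iff fun v h => hpos v (hL h),
      isTaut_flip_union_iff hpos hL (hnotTaut D hD)]
  constructor
  · rintro ⟨τ, hτ⟩
    let L : Finset Lit := C.filter fun l => l.1 = u ∨
      ∃ i, (l.1 = x i ∧ τ (x i) = true) ∨ (l.1 = x' i ∧ τ (x i) = false)
    have hLC : L ⊆ C := Finset.filter_subset _ _
    have hxC : ∀ i, ((x i, true) : Lit) ∈ C := fun i => (memC _).2 (Or.inr (Or.inl ⟨i, rfl⟩))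
    have hx'C : ∀ i, ((x' i, true) : Lit) ∈ C := fun i => (memC _).2 (Or.inr (Or.inr ⟨i, rfl⟩))
    have huL : ((u, true) : Lit) ∈ L :=
      Finset.mem_filter.2 ⟨(memC _).2 (Or.inl rfl), Or.inl rfl⟩
    have hxL : ∀ i, ((x i, true) : Lit) ∈ L ↔ τ (x i) = true := by
      intro i
      simp [L, hxC, (hux i).symm, hxx', hxinj.eq_iff]
    have hx'L : ∀ i, ((x' i, true) : Lit) ∈ L ↔ τ (x i) = false := by
      intro i
      simp [L, hx'C, (hux' i).symm, fun j => (hxx' j i).symm, hx'inj.eq_iff]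
    refine ⟨L, ⟨_, huL⟩, hLC, (hblocks L hLC).2 ((hforall _).2 ⟨?_, fun i => ⟨?_, ?_, ?_⟩⟩)⟩
    · rintro D hD -
      obtain ⟨⟨v, b⟩, hvD, hv⟩ := hτ D hD
      have hvx : v ∈ Set.range x := hFvars ▸ ⟨D, hD, _, hvD, rfl⟩
      obtain ⟨i, rfl⟩ := hvx
      left
      cases b
      · exact ⟨x' i, (memT_true _ _).2 (Or.inr ⟨i, hvD, rfl⟩), (hx'L i).2 hv⟩
      · exact ⟨x i, (memT_true _ _).2 (Or.inl ⟨i, hvD, rfl⟩), (hxL i).2 hv⟩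
    · intro _
      right
      cases h : τ (x i)
      · exact ⟨x i, by simp, hxC i, by simp [hxL, h]⟩
      · exact ⟨x' i, by simp, hx'C i, by simp [hx'L, h]⟩
    · exact fun _ => Or.inl ⟨u, by simp, huL⟩
    · exact fun _ => Or.inl ⟨u, by simp, huL⟩
  · rintro ⟨L, ⟨⟨v, b⟩, hv⟩, hLC, hL⟩
    rw [hblocks L hLC, hforall] at hL
    obtain ⟨hT', hgadget⟩ := hL
    have hxu : ∀ i, ((x i, true) : Lit) ∈ L → ((u, true) : Lit) ∈ L := by
      intro i hi
      simpa [hi] using (hgadget i).2.1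
    have hx'u : ∀ i, ((x' i, true) : Lit) ∈ L → ((u, true) : Lit) ∈ L := by
      intro i hi
      simpa [hi] using (hgadget i).2.2
    have hexcl : ∀ i, ((x' i, true) : Lit) ∈ L → ((x i, true) : Lit) ∉ L := by
      intro i hi' hi
      simpa [hi, hi'] using (hgadget i).1
    have huL : ((u, true) : Lit) ∈ L := by
      cases b
      · exact absurd (hLC hv) (hpos v)
      · rcases (memC v).1 (hLC hv) with rfl | ⟨i, rfl⟩ | ⟨i, rfl⟩
        · exact hv
        · exact hxu i hv
        · exact hx'u i hv
    refine ⟨fun v => decide (((v, true) : Lit) ∈ L), fun D hD => ?_⟩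
    rcases hT' D hD ⟨u, (memT_false _ _).2 rfl, huL⟩ with ⟨w, hw, hwL⟩ | ⟨w, hw, -, hwL⟩
    · rcases (memT_true _ _).1 hw with ⟨i, hi, rfl⟩ | ⟨i, hi, rfl⟩
      · exact ⟨_, hi, decide_eq_true hwL⟩
      · exact ⟨_, hi, decide_eq_false (hexcl i hwL)⟩
    · rw [memT_false] at hw
      exact absurd huL (hw ▸ hwL)
end

section
/- Correctness of the reduction from ∀∃-SAT to the super-blocking problem: let X and Y = {y_1, …, y_n} be disjoint finite sets of variables, let F be a formula with var(F) ⊆ X ∪ Y, and let u, y_1', …, y_n' be pairwise distinct fresh variables not in X ∪ Y. Let C = {u, y_1, y_1', …, y_n, y_n'}, for each clause D ∈ F let T(D) = {¬u} ∪ {l ∈ D | var(l) ∈ X} ∪ {y_i | y_i ∈ D} ∪ {y_i' | ¬y_i ∈ D}, and let F' = {T(D) | D ∈ F} ∪ ⋃_{i=1}^{n} { {¬y_i, ¬y_i'}, {¬y_i, u}, {¬y_i', u} }. Then the following are equivalent: (i) for every assignment σ_X whose domain is X there exists an assignment σ_Y whose domain is Y such that σ_X ∪ σ_Y satisfies F;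 (ii) C is semantically blocked in F'. -/
theorem forallExistsSat_iff_semBlocked_reduction (n : ℕ) (X : Finset Var)
    (y y' : Fin n → Var) (u : Var) (F : Formula)
    (hyinj : Function.Injective y) (hy'inj : Function.Injective y')
    (hyX : ∀ i : Fin n, y i ∉ X)
    (hFvars : formulaVars F ⊆ ↑X ∪ Set.range y)
    (hy'fresh : ∀ i : Fin n, y' i ∉ (↑X ∪ Set.range y : Set Var))
    (hufresh : u ∉ (↑X ∪ Set.range y : Set Var))
    (huy' : ∀ i : Fin n, u ≠ y' i)
    (C : Clause)
    (hC : C = insert ((u, true) : Lit)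
      ((Finset.univ.image fun i : Fin n => ((y i, true) : Lit)) ∪
       (Finset.univ.image fun i : Fin n => ((y' i, true) : Lit))))
    (T : Clause → Clause)
    (hT : ∀ D : Clause, T D = insert ((u, false) : Lit)
      ((D.filter fun l : Lit => l.1 ∈ X) ∪
       ((Finset.univ.filter fun i : Fin n => ((y i, true) : Lit) ∈ D).image
          fun i => ((y i, true) : Lit)) ∪
       ((Finset.univ.filter fun i : Fin n => ((y i, false) : Lit) ∈ D).image
          fun i => ((y' i, true) : Lit))))
    (F' : Formula)
    (hF' : F' = (T '' F) ∪
      ⋃ i : Fin n, ({ ({((y i, false) : Lit), ((y' i, false) : Lit)} : Clause),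
                      ({((y i, false) : Lit), ((u, true) : Lit)} : Clause),
                      ({((y' i, false) : Lit), ((u, true) : Lit)} : Clause) } : Set Clause)) :
    (∀ σX : PAssign, pdom σX = ↑X →
        ∃ σY : PAssign, pdom σY = Set.range y ∧ pformulaSat (punion σX σY) F)
      ↔ semBlocked F' C := by
  have hsat : ∀ τ : Assign, formulaSat τ F' ↔
      (∀ D ∈ F, τ u = false ∨ (∃ l ∈ D, l.1 ∈ X ∧ τ l.1 = l.2) ∨
        (∃ i, (y i, true) ∈ D ∧ τ (y i) = true) ∨
        (∃ i, (y i, false) ∈ D ∧ τ (y' i) = true)) ∧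
      ∀ i, (τ (y i) = false ∨ τ (y' i) = false) ∧ (τ (y i) = false ∨ τ u = true) ∧
        (τ (y' i) = false ∨ τ u = true) := by
    intro τ
    have hTsat : ∀ D, clauseSat τ (T D) ↔
        τ u = false ∨ (∃ l ∈ D, l.1 ∈ X ∧ τ l.1 = l.2) ∨
          (∃ i, (y i, true) ∈ D ∧ τ (y i) = true) ∨
          (∃ i, (y i, false) ∈ D ∧ τ (y' i) = true) := by
      intro D
      simp [hT, clauseSat, litSat, or_and_right, exists_or, and_assoc]
    rw [hF']
    constructor
    · intro h
      refine ⟨fun D hD => (hTsat D).1 (h _ (Or.inl ⟨D, hD, rfl⟩)), fun i => ⟨?_, ?_, ?_⟩⟩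
      · simpa [clauseSat, litSat] using
          h {(y i, false), (y' i, false)} (Or.inr (Set.mem_iUnion.2 ⟨i, by simp⟩))
      · simpa [clauseSat, litSat] using
          h {(y i, false), (u, true)} (Or.inr (Set.mem_iUnion.2 ⟨i, by simp⟩))
      · simpa [clauseSat, litSat] using
          h {(y' i, false), (u, true)} (Or.inr (Set.mem_iUnion.2 ⟨i, by simp⟩))
    · rintro ⟨h₁, h₂⟩ E (⟨D, hD, rfl⟩ | hE)
      · exact (hTsat D).2 (h₁ D hD)
      · obtain ⟨i, hi⟩ := Set.mem_iUnion.1 hE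
        obtain ⟨ha, hb, hc⟩ := h₂ i
        rcases hi with rfl | rfl | rfl
        · simpa [clauseSat, litSat] using ha
        · simpa [clauseSat, litSat] using hb
        · simpa [clauseSat, litSat] using hc
  have henv : env F' C = F' := by
    refine Set.Subset.antisymm (fun _ h => h.1) fun E hE => ⟨hE, ?_⟩
    rw [hF'] at hE
    rcases hE with ⟨D, -, rfl⟩ | hE
    · exact ⟨(u, false), by simp [hT], by simp [Lit.compl, hC]⟩
    · obtain ⟨i, hi⟩ := Set.mem_iUnion.1 hE
      rcases hi with rfl | rfl | rfl
      · exact ⟨(y i, false), by simp, by simp [Lit.compl, hC]⟩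
      · exact ⟨(y i, false), by simp, by simp [Lit.compl, hC]⟩
      · exact ⟨(y' i, false), by simp, by simp [Lit.compl, hC]⟩
  have hvars : ∀ v, v ∈ clauseVars C ↔ v = u ∨ (∃ i, y i = v) ∨ ∃ i, y' i = v := by
    intro v
    simp [hC, clauseVars, eq_comm]
  have hCsat : ∀ τ : Assign, clauseSat τ C ↔
      τ u = true ∨ (∃ i, τ (y i) = true) ∨ ∃ i, τ (y' i) = true := by
    intro τ
    simp [hC, clauseSat, litSat, or_and_right, exists_or]
  have hy'X : ∀ i, y' i ∉ X := fun i h => hy'fresh i (Or.inl h)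
  have hy'y : ∀ i j, y j ≠ y' i := fun i j h => hy'fresh i (Or.inr ⟨j, h⟩)
  have huX : u ∉ X := fun h => hufresh (Or.inl h)
  have huy : ∀ i, y i ≠ u := fun i h => hufresh (Or.inr ⟨i, h⟩)
  have hXvars : ∀ v ∈ X, v ∉ clauseVars C := by
    intro v hv h
    rcases (hvars v).1 h with rfl | ⟨i, rfl⟩ | ⟨i, rfl⟩
    exacts [huX hv, hyX i hv, hy'X i hv]
  have hlit : ∀ D ∈ F, ∀ l ∈ D, l.1 ∈ X ∨ ∃ i, y i = l.1 := fun D hD l hl =>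
    hFvars ⟨D, hD, l, hl, rfl⟩
  unfold semBlocked
  rw [henv]
  constructor
  · intro h τ _
    classical
    obtain ⟨σY, hσY, hs⟩ := h (fun v => if v ∈ X then some (τ v) else none) (by
      ext v
      simp [pdom])
    let τ' : Assign := fun v =>
      if v = u then true
      else if ∃ i, y i = v then (σY v).getD false
      else if h : ∃ i, y' i = v then !(σY (y h.choose)).getD false
      else τ v
    have hτu : τ' u = true := by simp [τ']
    have hτy : ∀ i, τ' (y i) = (σY (y i)).getD false := by
      intro i
      simp [τ', huy]
    have hτy' : ∀ i, τ' (y' i) = !(σY (y i)).getD false := by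
      intro i
      have hex : ∃ j, y' j = y' i := ⟨i, rfl⟩
      have hi : hex.choose = i := hy'inj hex.choose_spec
      simp only [τ', if_neg (huy' i).symm, dif_pos hex, hi]
      rw [if_neg (fun ⟨j, hj⟩ => hy'y i j hj)]
    have hτ : ∀ v, v ∉ clauseVars C → τ v = τ' v := by
      intro v hv
      rw [hvars] at hv
      push Not at hv
      simp [τ', hv.1, hv.2.1, hv.2.2]
    refine ⟨τ', ?_, hτ⟩
    rintro E (hE | rfl)
    · refine (hsat τ').2 ⟨fun D hD => Or.inr ?_, fun i => ⟨?_, Or.inr hτu, Or.inr hτu⟩⟩ E hE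
      · obtain ⟨l, hl, hls⟩ := hs D hD
        rcases hlit D hD l hl with hX | ⟨i, hi⟩
        · refine Or.inl ⟨l, hl, hX, ?_⟩
          rw [← hτ _ (hXvars _ hX)]
          simpa [plitSat, punion, hX] using hls
        · obtain ⟨v, b⟩ := l
          obtain rfl : y i = v := hi
          have hb : σY (y i) = some b := by simpa [plitSat, punion, hyX] using hls
          cases b
          · exact Or.inr (Or.inr ⟨i, hl, by simp [hτy', hb]⟩)
          · exact Or.inr (Or.inl ⟨i, hl, by simp [hτy, hb]⟩)
      · rw [hτy, hτy']
        cases (σY (y i)).getD false <;> simp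
    · exact (hCsat τ').2 (Or.inl hτu)
  · intro h σX hσX
    classical
    have hdom : ∀ v, σX v ≠ none ↔ v ∈ X := fun v => Set.ext_iff.1 hσX v
    let τ : Assign := fun v => (σX v).getD false
    have hτnone : ∀ v, v ∉ X → τ v = false := by
      intro v hv
      simp [τ, not_ne_iff.1 (mt (hdom v).1 hv)]
    obtain ⟨τ', hs, hag⟩ := h τ ((hsat τ).2 ⟨fun D _ => Or.inl (hτnone u huX), fun i =>
      ⟨Or.inl (hτnone _ (hyX i)), Or.inl (hτnone _ (hyX i)), Or.inl (hτnone _ (hy'X i))⟩⟩)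
    obtain ⟨h₁, h₂⟩ := (hsat τ').1 fun E hE => hs E (Or.inl hE)
    have hu : τ' u = true := by
      rcases (hCsat τ').1 (hs C (Or.inr rfl)) with hu | ⟨i, hi⟩ | ⟨i, hi⟩
      · exact hu
      · simpa [hi] using (h₂ i).2.1
      · simpa [hi] using (h₂ i).2.2
    refine ⟨fun v => if v ∈ Set.range y then some (τ' v) else none, ?_, ?_⟩
    · ext v
      simp [pdom]
    · have hpy : ∀ i, punion σX (fun v => if v ∈ Set.range y then some (τ' v) else none) (y i)
          = some (τ' (y i)) := by
        intro i
        simp [punion, not_ne_iff.1 (mt (hdom (y i)).1 (hyX i))]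
      intro D hD
      rcases h₁ D hD with hu' | ⟨l, hl, hX, hb⟩ | ⟨i, hi, hb⟩ | ⟨i, hi, hb⟩
      · simp [hu] at hu'
      · refine ⟨l, hl, ?_⟩
        obtain ⟨b, hσ⟩ := Option.ne_none_iff_exists'.1 ((hdom l.1).2 hX)
        have := hag _ (hXvars _ hX)
        simp only [τ, hσ, hb, Option.getD_some] at this
        simp [plitSat, punion, hσ, this]
      · exact ⟨_, hi, by simp only [plitSat, hpy, hb]⟩
      · have hf : τ' (y i) = false := by simpa [hb] using (h₂ i).1
        exact ⟨_, hi, by simp only [plitSat, hpy, hf]⟩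
end

section
/- Correctness of the reduction from UNSAT to the 1-super-blocking problem: let F = {C_1, …, C_n} be a formula and u_1, …, u_n pairwise distinct fresh variables not occurring in F. Let C = {u_1, …, u_n} and F' = ⋃_{i=1}^{n} { {¬u_i, l̄} | l ∈ C_i }. Then F is unsatisfiable if and only if for every assignment τ whose domain is exactly ext_{F'}(C) there exists an index i such that the singleton set {u_i} blocks C in F'|τ. -/
theorem mem_reduction_iff {n : ℕ} {Cl : Fin n → Clause} {u : Fin n → Var} {D : Clause} :
    D ∈ (⋃ i : Fin n, (fun l : Lit => ({(u i, false), Lit.compl l} : Clause)) '' ↑(Cl i)) ↔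
      ∃ i, ∃ l ∈ Cl i, D = {(u i, false), Lit.compl l} := by
  simp [eq_comm]

theorem ne_of_fresh {n : ℕ} {Cl : Fin n → Clause} {u : Fin n → Var}
    (hufresh : ∀ i : Fin n, u i ∉ formulaVars (Set.range Cl))
    {i j : Fin n} {l : Lit} (hl : l ∈ Cl j) : l.1 ≠ u i :=
  fun h => hufresh i ⟨Cl j, ⟨j, rfl⟩, l, hl, h⟩

/-- The external variables of the clause of fresh variables are the variables of the formula. -/
theorem extVars_reduction {n : ℕ} {Cl : Fin n → Clause} {u : Fin n → Var}
    (hufresh : ∀ i : Fin n, u i ∉ formulaVars (Set.range Cl)) :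
    extVars (⋃ i : Fin n, (fun l : Lit => ({(u i, false), Lit.compl l} : Clause)) '' ↑(Cl i))
      (Finset.univ.image fun i : Fin n => ((u i, true) : Lit)) =
        formulaVars (Set.range Cl) := by
  ext v
  constructor
  · rintro ⟨⟨D, ⟨hD, -⟩, k, hk, rfl⟩, hv⟩
    obtain ⟨i, l, hl, rfl⟩ := mem_reduction_iff.1 hD
    rcases Finset.mem_insert.1 hk with rfl | hk
    · exact absurd ⟨(u i, true), by simp, rfl⟩ hv
    · rw [Finset.mem_singleton.1 hk]
      exact ⟨Cl i, ⟨i, rfl⟩, l, hl, rfl⟩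
  · rintro ⟨_, ⟨i, rfl⟩, l, hl, rfl⟩
    refine ⟨⟨{(u i, false), Lit.compl l}, ⟨mem_reduction_iff.2 ⟨i, l, hl, rfl⟩,
      (u i, false), by simp, by simp [Lit.compl]⟩, Lit.compl l, by simp, rfl⟩, ?_⟩
    rintro ⟨k, hk, hkl⟩
    obtain ⟨j, -, rfl⟩ := Finset.mem_image.1 hk
    exact ne_of_fresh hufresh hl hkl.symm

/-- A fresh literal blocks the clause of fresh variables in the restricted reduction exactly when
the assignment falsifies every literal of the corresponding clause. -/
theorem blocksSet_reduction_iff {n : ℕ} {Cl : Fin n → Clause} {u : Fin n → Var}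
    (huinj : Function.Injective u)
    (hufresh : ∀ i : Fin n, u i ∉ formulaVars (Set.range Cl))
    {τ : PAssign} (hτ : ∀ i, τ (u i) = none) (i : Fin n) :
    blocksSet
      (restrictF
        (⋃ i : Fin n, (fun l : Lit => ({(u i, false), Lit.compl l} : Clause)) '' ↑(Cl i)) τ)
      (Finset.univ.image fun i : Fin n => ((u i, true) : Lit)) {((u i, true) : Lit)} ↔
        ∀ l ∈ Cl i, plitSat τ (Lit.compl l) := by
  constructor
  · rintro ⟨-, -, h⟩ l hl
    by_contra hs
    have hlu (j : Fin n) : l.1 ≠ u j := ne_of_fresh hufresh hl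
    obtain ⟨k, hk, hk'⟩ := h {(u i, false), Lit.compl l}
      ⟨mem_reduction_iff.2 ⟨i, l, hl, rfl⟩, by
        rintro ⟨k, hk, hkτ⟩
        rcases Finset.mem_insert.1 hk with rfl | hk
        · simp [plitSat, hτ] at hkτ
        · exact hs (Finset.mem_singleton.1 hk ▸ hkτ)⟩
      ⟨(u i, false), by simp [complSet, Lit.compl]⟩
    obtain ⟨v, b⟩ := k
    obtain ⟨w, c⟩ := l
    simp only [complSet, Lit.compl, Finset.mem_union, Finset.mem_sdiff, Finset.mem_image,
      Finset.mem_univ, true_and, Finset.mem_singleton, Finset.mem_insert, Prod.mk.injEq,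
      Finset.image_singleton] at hk hk' hlu
    grind
  · intro h
    refine ⟨by simp, by simp, ?_⟩
    rintro D ⟨hD, hDτ⟩ ⟨k, hk⟩
    obtain ⟨j, l, hl, rfl⟩ := mem_reduction_iff.1 hD
    obtain ⟨hkD, hk⟩ := Finset.mem_inter.1 hk
    have hk : k = (u i, false) := by simpa [complSet, Lit.compl] using hk
    subst hk
    rcases Finset.mem_insert.1 hkD with hkD | hkD
    · obtain rfl : i = j := huinj (congrArg Prod.fst hkD)
      exact absurd ⟨Lit.compl l, by simp, h l hl⟩ hDτ
    · have hul : u i = l.1 := congrArg Prod.fst (Finset.mem_singleton.1 hkD)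
      exact absurd hul.symm (ne_of_fresh hufresh hl)

theorem unsat_iff_oneSuperBlocked_reduction (n : ℕ) (Cl : Fin n → Clause)
    (u : Fin n → Var)
    (huinj : Function.Injective u)
    (hufresh : ∀ i : Fin n, u i ∉ formulaVars (Set.range Cl))
    (C : Clause) (hC : C = Finset.univ.image fun i : Fin n => ((u i, true) : Lit))
    (F' : Formula)
    (hF' : F' = ⋃ i : Fin n,
      (fun l : Lit => ({(u i, false), Lit.compl l} : Clause)) '' ↑(Cl i)) :
    ¬ satisfiable (Set.range Cl) ↔
      ∀ τ : PAssign, pdom τ = extVars F' C →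
        ∃ i : Fin n, blocksSet (restrictF F' τ) C {((u i, true) : Lit)} := by
  subst hC hF'
  rw [extVars_reduction hufresh]
  have hnone {τ : PAssign} (hτ : pdom τ = formulaVars (Set.range Cl)) (i : Fin n) :
      τ (u i) = none := by
    by_contra h
    exact hufresh i (hτ ▸ h)
  constructor
  · intro hunsat τ hτ
    by_contra! hcon
    refine hunsat ⟨fun v => (τ v).getD false, ?_⟩
    rintro _ ⟨i, rfl⟩
    have hi := hcon i
    rw [blocksSet_reduction_iff huinj hufresh (hnone hτ)] at hi
    push Not at hi
    obtain ⟨l, hl, hlτ⟩ := hi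
    have hdom : τ l.1 ≠ none := by
      change l.1 ∈ pdom τ
      exact hτ ▸ ⟨Cl i, ⟨i, rfl⟩, l, hl, rfl⟩
    obtain ⟨b, hb⟩ := Option.ne_none_iff_exists'.1 hdom
    refine ⟨l, hl, ?_⟩
    simp only [plitSat, Lit.compl, hb, Option.some.injEq] at hlτ
    simpa [litSat, hb] using hlτ
  · rintro h ⟨σ, hσ⟩
    classical
    let τ : PAssign := fun v => if v ∈ formulaVars (Set.range Cl) then some (σ v) else none
    have hτ : pdom τ = formulaVars (Set.range Cl) := by
      ext v
      simp [pdom, τ]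
    obtain ⟨i, hi⟩ := h τ hτ
    rw [blocksSet_reduction_iff huinj hufresh (hnone hτ)] at hi
    obtain ⟨l, hl, hlσ⟩ := hσ (Cl i) ⟨i, rfl⟩
    have hmem : l.1 ∈ formulaVars (Set.range Cl) := ⟨Cl i, ⟨i, rfl⟩, l, hl, rfl⟩
    have hlτ := hi l hl
    simp only [litSat] at hlσ
    simp [plitSat, Lit.compl, τ, hmem, hlσ] at hlτ
end

section
/- Set-blocking is not subsumed by resolution asymmetric tautologies: there exist a formula F and a clause C such that C is set-blocked in F but (F, C) is not a resolution asymmetric tautology (RAT) pair. -/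
/-- A clause that already contains all its asymmetric literals is an asymmetric tautology only if
it is a tautology. -/
theorem isTaut_of_asymTaut_of_closed {F : Formula} {C : Clause}
    (hC : ∀ l, asymLit F C l → l ∈ C) (h : asymTaut F C) : Clause.isTaut C := by
  obtain ⟨ls, htaut, hls⟩ := h
  have key : ∀ n (hn : n < ls.length), ls[n] ∈ C := by
    intro n
    induction n using Nat.strong_induction_on with
    | _ n ih =>
      intro hn
      have hsub : (ls.take n).toFinset ⊆ C := by
        intro l hl
        rw [List.mem_toFinset, List.mem_take_iff_getElem] at hl
        obtain ⟨j, hj, rfl⟩ := hl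
        exact ih j (by omega) (by omega)
      have hlit := hls ⟨n, hn⟩
      rw [Finset.union_eq_left.mpr hsub] at hlit
      exact hC _ hlit
  have hsub : ls.toFinset ⊆ C := by
    intro l hl
    rw [List.mem_toFinset, List.mem_iff_getElem] at hl
    obtain ⟨j, hj, rfl⟩ := hl
    exact key j hj
  rwa [Finset.union_eq_left.mpr hsub] at htaut

/-- The clause `x₀ ∨ x₁` contains all its asymmetric literals in the formula `x₀ ↔ x₁`. -/
theorem mem_of_asymLit_iff_formula (l : Lit)
    (h : asymLit {{(0, false), (1, true)}, {(0, true), (1, false)}} {(0, true), (1, true)} l) :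
    l ∈ ({(0, true), (1, true)} : Clause) := by
  obtain ⟨D, hD, hF, -⟩ := h
  have hneg : ∀ v : Var, (v, false) ∉ D := fun v hv => by simpa using hD hv
  have hmem : ∀ v : Var, (v, false) ∈ insert (Lit.compl l) D → l = (v, true) := by
    intro v hv
    rcases Finset.mem_insert.mp hv with hv | hv
    · obtain ⟨w, b⟩ := l
      simp_all [Lit.compl]
    · exact absurd hv (hneg v)
  rcases hF with hF | hF
  · simp [hmem 0 (by rw [hF]; simp)]
  · simp [hmem 1 (by rw [Set.mem_singleton_iff.mp hF]; simp)]

theorem setBlocked_not_subsumed_by_rat :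
    ∃ (F : Formula) (C : Clause), setBlocked F C ∧ ¬ ratPair F C := by
  refine ⟨{{(0, false), (1, true)}, {(0, true), (1, false)}}, {(0, true), (1, true)},
    ⟨{(0, true), (1, true)}, by simp, subset_rfl, ?_⟩, ?_⟩
  · rintro D (rfl | rfl) -
    · exact ⟨(1, true), by decide, by decide⟩
    · exact ⟨(0, true), by decide, by decide⟩
  · have hnot : ¬ asymTaut {{(0, false), (1, true)}, {(0, true), (1, false)}}
        {(0, true), (1, true)} := fun h => by
      obtain ⟨l, hl, hl'⟩ := isTaut_of_asymTaut_of_closed mem_of_asymLit_iff_formula h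
      revert l
      decide
    rintro (h | ⟨l, hl, h⟩)
    · exact hnot h
    · rw [Finset.mem_insert, Finset.mem_singleton] at hl
      rcases hl with rfl | rfl
      · exact hnot (h {(0, false), (1, true)} (Or.inl rfl) (by decide))
      · have h' := h {(0, true), (1, false)} (Or.inr rfl) (by decide)
        rw [show ({(0, true), (1, true)} : Clause) ∪
          Finset.erase {(0, true), (1, false)} (Lit.compl (1, true)) =
            {(0, true), (1, true)} by decide] at h'
        exact hnot h'
end
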